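/- Main theorem: For most pairs (K,L) in the space of pairs of convex bodies in ℝ^n (in the sense of Baire category with the Hausdorff product metric), K and L are strictly convex, and for most u ∈ S^{n−1}, for most t ∈ T_u, the reverse Gauss map x_{K,L} = x_K − x_L makes a turn at u in direction t, i.e., for every ε > 0 there exist 0 < λ, μ < ε with ⟨x_{K,L}(u⊞λt) − x_{K,L}(u), t⟩·⟨x_{K,L}(u⊞(−μ)t) − x_{K,L}(u), t⟩ > 0. -/

import Mathlib

open scoped RealInnerProductSpace

variable {n : ℕ}

/-- `u ⊞ λt = (u + λt)/‖u + λt‖`. -/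
noncomputable def boxplus (u t : EuclideanSpace ℝ (Fin n)) (l : ℝ) : EuclideanSpace ℝ (Fin n) :=
  ‖u + l • t‖⁻¹ • (u + l • t)

/-- The map `x` makes a turn at `u` in direction `t`: for every `ε > 0` there are
`0 < λ, μ < ε` with `⟪x(u⊞λt) − x(u), t⟫ · ⟪x(u⊞(−μ)t) − x(u), t⟫ > 0`. -/
def MakesTurn (x : EuclideanSpace ℝ (Fin n) → EuclideanSpace ℝ (Fin n))
    (u t : EuclideanSpace ℝ (Fin n)) : Prop :=
  ∀ ε : ℝ, 0 < ε → ∃ lam mu : ℝ, 0 < lam ∧ lam < ε ∧ 0 < mu ∧ mu < ε ∧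
    0 < ⟪x (boxplus u t lam) - x u, t⟫ * ⟪x (boxplus u t (-mu)) - x u, t⟫

open Filter Topology Set

section SupportPoints

variable {E : Type*} [NormedAddCommGroup E] [InnerProductSpace ℝ E]

/-- `p` is a point of `K` maximizing the linear functional `⟪·, v⟫`. -/
def IsSupportPoint (K : ConvexBody E) (v p : E) : Prop :=
  p ∈ K ∧ ∀ y ∈ K, ⟪y, v⟫ ≤ ⟪p, v⟫

/-- `p` is the unique point of `K` maximizing the linear functional `⟪·, v⟫`. -/
def IsExposedPoint (K : ConvexBody E) (v p : E) : Prop :=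
  p ∈ K ∧ ∀ y ∈ K, y ≠ p → ⟪y, v⟫ < ⟪p, v⟫

theorem IsExposedPoint.add {K L : ConvexBody E} {v p q : E} (hp : IsExposedPoint K v p)
    (hq : IsExposedPoint L v q) : IsExposedPoint (K + L) v (p + q) := by
  have hmem : ∀ y, y ∈ K + L ↔ ∃ a ∈ K, ∃ b ∈ L, a + b = y := fun y => by
    rw [← SetLike.mem_coe, ConvexBody.coe_add, Set.mem_add]; rfl
  refine ⟨(hmem _).2 ⟨p, hp.1, q, hq.1, rfl⟩, fun y hy hne => ?_⟩
  obtain ⟨a, ha, b, hb, rfl⟩ := (hmem y).1 hy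
  rw [inner_add_left, inner_add_left]
  by_cases hap : a = p
  · subst hap
    have hbq : b ≠ q := fun h => hne (by rw [h])
    linarith [hq.2 b hb hbq]
  · by_cases hbq : b = q
    · subst hbq
      linarith [hp.2 a ha hap]
    · linarith [hp.2 a ha hap, hq.2 b hb hbq]

/-- The segment joining the origin to `w`. -/
def ConvexBody.zeroSegment (w : E) : ConvexBody E where
  carrier := segment ℝ 0 w
  convex' := convex_segment 0 w
  isCompact' := by
    rw [segment_eq_image]
    exact isCompact_Icc.image (by fun_prop)
  nonempty' := ⟨0, left_mem_segment ℝ 0 w⟩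

theorem ConvexBody.mem_zeroSegment {w y : E} :
    y ∈ ConvexBody.zeroSegment w ↔ ∃ s ∈ Icc (0 : ℝ) 1, s • w = y := by
  change y ∈ segment ℝ 0 w ↔ _
  rw [segment_eq_image]
  simp

theorem isExposedPoint_zeroSegment_of_pos {w v : E} (h : 0 < ⟪w, v⟫) :
    IsExposedPoint (ConvexBody.zeroSegment w) v w := by
  refine ⟨ConvexBody.mem_zeroSegment.2 ⟨1, by simp, by simp⟩, fun y hy hne => ?_⟩
  obtain ⟨s, ⟨_, hs⟩, rfl⟩ := ConvexBody.mem_zeroSegment.1 hy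
  have hs1 : s < 1 := lt_of_le_of_ne hs fun h => hne (by rw [h, one_smul])
  rw [real_inner_smul_left]
  nlinarith

theorem isExposedPoint_zeroSegment_of_neg {w v : E} (h : ⟪w, v⟫ < 0) :
    IsExposedPoint (ConvexBody.zeroSegment w) v 0 := by
  refine ⟨ConvexBody.mem_zeroSegment.2 ⟨0, by simp, by simp⟩, fun y hy hne => ?_⟩
  obtain ⟨s, ⟨hs, _⟩, rfl⟩ := ConvexBody.mem_zeroSegment.1 hy
  have hs0 : 0 < s := lt_of_le_of_ne hs fun h => hne (by rw [← h, zero_smul])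
  rw [real_inner_smul_left, inner_zero_left]
  nlinarith

theorem ConvexBody.dist_add_zeroSegment_le (K : ConvexBody E) (w : E) :
    dist (K + ConvexBody.zeroSegment w) K ≤ ‖w‖ := by
  rw [← ConvexBody.hausdorffDist_coe, ConvexBody.coe_add]
  refine Metric.hausdorffDist_le_of_mem_dist (norm_nonneg w) ?_ ?_
  · intro y hy
    obtain ⟨a, ha, b, hb, rfl⟩ := Set.mem_add.1 hy
    obtain ⟨s, ⟨hs0, hs1⟩, rfl⟩ := ConvexBody.mem_zeroSegment.1 hb
    refine ⟨a, ha, ?_⟩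
    rw [dist_eq_norm, add_sub_cancel_left, norm_smul, Real.norm_of_nonneg hs0]
    exact mul_le_of_le_one_left (norm_nonneg w) hs1
  · intro y hy
    refine ⟨y, Set.mem_add.2 ⟨y, hy, 0, left_mem_segment ℝ 0 w, add_zero y⟩, ?_⟩
    simp

theorem IsSupportPoint.isExposedPoint {K : ConvexBody E} (hK : StrictConvex ℝ (K : Set E))
    {v p : E} (hv : v ≠ 0) (hp : IsSupportPoint K v p) : IsExposedPoint K v p := by
  refine ⟨hp.1, fun y hy hne => lt_of_not_ge fun hle => ?_⟩
  have hmid : (1 / 2 : ℝ) • y + (1 / 2 : ℝ) • p ∈ interior (K : Set E) :=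
    hK hy hp.1 hne (by norm_num) (by norm_num) (by norm_num)
  have hlim : Tendsto (fun s : ℝ => ((1 / 2 : ℝ) • y + (1 / 2 : ℝ) • p) + s • v) (𝓝[>] 0)
      (𝓝 ((1 / 2 : ℝ) • y + (1 / 2 : ℝ) • p)) := by
    refine Tendsto.mono_left ?_ nhdsWithin_le_nhds
    have hc : Continuous fun s : ℝ => ((1 / 2 : ℝ) • y + (1 / 2 : ℝ) • p) + s • v := by fun_prop
    simpa using hc.tendsto 0
  obtain ⟨s, hs, hs0⟩ :=
    ((hlim.eventually (mem_interior_iff_mem_nhds.1 hmid)).and self_mem_nhdsWithin).exists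
  have h := hp.2 _ hs
  simp only [inner_add_left, real_inner_smul_left] at h
  have hvv : 0 < ⟪v, v⟫ := real_inner_self_pos.2 hv
  have := mul_pos hs0 hvv
  linarith

theorem tendsto_supportPoint {ι : Type*} {l : Filter ι} {K : ConvexBody E} {v p : E}
    (hp : IsExposedPoint K v p) {κ : ι → ConvexBody E} {w y : ι → E} (hκ : Tendsto κ l (𝓝 K))
    (hw : Tendsto w l (𝓝 v)) (hy : ∀ᶠ i in l, IsSupportPoint (κ i) (w i) (y i)) :
    Tendsto y l (𝓝 p) := by
  rw [Metric.tendsto_nhds]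
  intro η hη
  obtain ⟨γ, hγ, hgap⟩ : ∃ γ > 0, ∀ k ∈ K, ⟪p, v⟫ - γ < ⟪k, v⟫ → dist k p < η / 2 := by
    have hcomp : IsCompact ((K : Set E) \ Metric.ball p (η / 2)) :=
      K.isCompact.diff Metric.isOpen_ball
    rcases Set.eq_empty_or_nonempty ((K : Set E) \ Metric.ball p (η / 2)) with hemp | hne
    · refine ⟨1, one_pos, fun k hk _ => ?_⟩
      by_contra hcon
      have : k ∈ (K : Set E) \ Metric.ball p (η / 2) := ⟨hk, hcon⟩
      simp [hemp] at this
    · obtain ⟨m, hm, hmax⟩ := hcomp.exists_isMaxOn hne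
        (f := fun z => ⟪z, v⟫) (by fun_prop)
      have hmp : m ≠ p := by
        rintro rfl
        exact hm.2 (Metric.mem_ball_self (by linarith))
      refine ⟨⟪p, v⟫ - ⟪m, v⟫, sub_pos.2 (hp.2 m hm.1 hmp), fun k hk hlt => ?_⟩
      by_contra hcon
      have : ⟪k, v⟫ ≤ ⟪m, v⟫ := hmax (a := k) ⟨hk, hcon⟩
      linarith
  obtain ⟨R, hR0, hR⟩ := K.isBounded.exists_pos_norm_le
  set M : ℝ := 2 * (‖v‖ + 1 + R) with hM
  have hMpos : 0 < M := by positivity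
  obtain ⟨δ, hδ0, hδ1, hδη, hδγ⟩ : ∃ δ > 0, δ ≤ 1 ∧ δ ≤ η / 2 ∧ δ * M ≤ γ / 2 := by
    refine ⟨min 1 (min (η / 2) (γ / 2 / M)), by positivity, min_le_left _ _,
      (min_le_right _ _).trans (min_le_left _ _), ?_⟩
    rw [← le_div_iff₀ hMpos]
    exact (min_le_right _ _).trans (min_le_right _ _)
  filter_upwards [hy, Metric.tendsto_nhds.1 hκ δ hδ0, Metric.tendsto_nhds.1 hw δ hδ0]
    with i hyi hκi hwi
  rw [← ConvexBody.hausdorffDist_coe] at hκi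
  obtain ⟨k, hk, hyk⟩ := Metric.exists_dist_lt_of_hausdorffDist_lt hyi.1 hκi
    ConvexBody.hausdorffEDist_ne_top
  obtain ⟨r, hr, hrp⟩ := Metric.exists_dist_lt_of_hausdorffDist_lt' hp.1 hκi
    ConvexBody.hausdorffEDist_ne_top
  have hwn : ‖w i‖ ≤ ‖v‖ + 1 := by
    have := norm_sub_norm_le (w i) v
    rw [← dist_eq_norm] at this
    linarith
  have key : ∀ a b : E, dist a b < δ → b ∈ K → |⟪a, w i⟫ - ⟪b, v⟫| ≤ δ * (‖v‖ + 1 + R) := by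
    intro a b hab hb
    have h1 : ⟪a, w i⟫ - ⟪b, v⟫ = ⟪a - b, w i⟫ + ⟪b, w i - v⟫ := by
      rw [inner_sub_left, inner_sub_right]; ring
    have h2 := abs_real_inner_le_norm (a - b) (w i)
    have h3 := abs_real_inner_le_norm b (w i - v)
    rw [← dist_eq_norm] at h2 h3
    have h4 : dist a b * ‖w i‖ ≤ δ * (‖v‖ + 1) := by gcongr
    have h5 : ‖b‖ * dist (w i) v ≤ R * δ := by gcongr; exact hR b hb
    rw [h1]
    refine (abs_add_le _ _).trans ?_
    linarith
  have h1 := abs_le.1 (key _ _ hyk hk)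
  have h2 := abs_le.1 (key _ _ hrp hp.1)
  have h3 := hyi.2 r hr
  have hkp := hgap k hk (by
    have : δ * M = 2 * (δ * (‖v‖ + 1 + R)) := by rw [hM]; ring
    linarith [h1.1, h1.2, h2.1, h2.2])
  calc dist (y i) p ≤ dist (y i) k + dist k p := dist_triangle _ _ _
    _ < η := by linarith

theorem ConvexBody.exists_isSupportPoint (K : ConvexBody E) (v : E) :
    ∃ p, IsSupportPoint K v p := by
  obtain ⟨p, hp, hmax⟩ := K.isCompact.exists_isMaxOn K.nonempty (f := fun z => ⟪z, v⟫)
    (by fun_prop)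
  exact ⟨p, hp, fun y hy => hmax hy⟩

variable [FiniteDimensional ℝ E]

theorem dense_strictConvex : Dense {K : ConvexBody E | StrictConvex ℝ (K : Set E)} := by
  rw [Metric.dense_iff]
  intro K ε hε
  obtain ⟨R, hR0, hR⟩ := K.isBounded.exists_pos_norm_le
  obtain ⟨δ, hδ0, hδε⟩ : ∃ δ > 0, δ < ε := ⟨ε / 2, by positivity, by linarith⟩
  set a : ℝ := δ / R ^ 2 with ha
  have ha0 : 0 < a := by positivity
  set f : E → ℝ := fun y => Metric.infDist y (K : Set E) + a * ‖y‖ ^ 2 with hf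
  have hfc : Continuous f := by
    have := Metric.continuous_infDist_pt (K : Set E)
    fun_prop
  have hlt : ∀ y z, f y ≤ δ → f z ≤ δ → y ≠ z → ∀ b c : ℝ, 0 < b → 0 < c → b + c = 1 →
      f (b • y + c • z) < δ := by
    intro y z hy hz hyz b c hb hc hbc
    obtain ⟨k, hk, hky⟩ := K.isCompact.exists_infDist_eq_dist K.nonempty y
    obtain ⟨m, hm, hmz⟩ := K.isCompact.exists_infDist_eq_dist K.nonempty z
    have h1 : Metric.infDist (b • y + c • z) (K : Set E) ≤ b * dist y k + c * dist z m := by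
      refine (Metric.infDist_le_dist_of_mem (K.convex hk hm hb.le hc.le hbc)).trans ?_
      rw [dist_eq_norm, dist_eq_norm, dist_eq_norm]
      calc ‖b • y + c • z - (b • k + c • m)‖ = ‖b • (y - k) + c • (z - m)‖ := by
            congr 1; module
        _ ≤ _ := norm_add_le _ _
        _ = _ := by rw [norm_smul, norm_smul, Real.norm_of_nonneg hb.le, Real.norm_of_nonneg hc.le]
    have h2 : ‖b • y + c • z‖ ^ 2 = b * ‖y‖ ^ 2 + c * ‖z‖ ^ 2 - b * c * ‖y - z‖ ^ 2 := by
      rw [norm_add_sq_real, norm_sub_sq_real, norm_smul, norm_smul, real_inner_smul_left,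
        real_inner_smul_right, Real.norm_of_nonneg hb.le, Real.norm_of_nonneg hc.le]
      obtain rfl : c = 1 - b := by linarith
      ring
    have h3 : 0 < a * (b * c * ‖y - z‖ ^ 2) := by
      have := norm_pos_iff.2 (sub_ne_zero.2 hyz)
      positivity
    simp only [hf, hky, hmz] at hy hz ⊢
    rw [h2]
    have h4 := mul_le_mul_of_nonneg_left hy hb.le
    have h5 := mul_le_mul_of_nonneg_left hz hc.le
    have h6 : b * δ + c * δ = δ := by rw [← add_mul, hbc, one_mul]
    nlinarith
  have hsub : {y | f y < δ} ⊆ interior {y | f y ≤ δ} :=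
    interior_maximal (fun y hy => le_of_lt (mem_ofPred.1 hy)) (isOpen_lt hfc continuous_const)
  have hSC : StrictConvex ℝ {y | f y ≤ δ} := fun y hy z hz hyz b c hb hc hbc =>
    hsub (hlt y z hy hz hyz b c hb hc hbc)
  have hKsub : (K : Set E) ⊆ {y | f y ≤ δ} := by
    intro y hy
    change Metric.infDist y (K : Set E) + a * ‖y‖ ^ 2 ≤ δ
    rw [Metric.infDist_zero_of_mem hy, zero_add, ha, div_mul_eq_mul_div,
      div_le_iff₀ (by positivity)]
    have := hR y hy
    gcongr
  have hinf : ∀ y, f y ≤ δ → Metric.infDist y (K : Set E) ≤ δ := by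
    intro y hy
    have : 0 ≤ a * ‖y‖ ^ 2 := by positivity
    simp only [hf] at hy
    linarith
  have hcomp : IsCompact {y | f y ≤ δ} := by
    refine Metric.isCompact_of_isClosed_isBounded (isClosed_le hfc continuous_const) ?_
    refine isBounded_iff_forall_norm_le.2 ⟨δ + R, fun y hy => ?_⟩
    obtain ⟨k, hk, hky⟩ := K.isCompact.exists_infDist_eq_dist K.nonempty y
    have h1 := hinf y hy
    rw [hky, dist_eq_norm] at h1
    linarith [norm_le_norm_add_norm_sub k y, norm_sub_rev k y, hR k hk]
  refine ⟨⟨{y | f y ≤ δ}, hSC.convex, hcomp, K.nonempty.mono hKsub⟩, ?_, hSC⟩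
  rw [Metric.mem_ball, ← ConvexBody.hausdorffDist_coe]
  refine lt_of_le_of_lt (Metric.hausdorffDist_le_of_infDist hδ0.le hinf fun y hy => ?_) hδε
  exact (Metric.infDist_zero_of_mem (hKsub hy)).trans_le hδ0.le

theorem ConvexBody.strictConvex_of_isSupportPoint_unique {K : ConvexBody E}
    (h : ∀ v : E, ‖v‖ = 1 → ∀ p q, IsSupportPoint K v p → IsSupportPoint K v q → p = q) :
    StrictConvex ℝ (K : Set E) := by
  have h' : ∀ v : E, v ≠ 0 → ∀ p q, IsSupportPoint K v p → IsSupportPoint K v q → p = q := by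
    intro v hv p q hp hq
    have hv' : 0 < ‖v‖⁻¹ := inv_pos.2 (norm_pos_iff.2 hv)
    refine h (‖v‖⁻¹ • v) (norm_smul_inv_norm hv) p q ⟨hp.1, fun y hy => ?_⟩
      ⟨hq.1, fun y hy => ?_⟩
    · rw [real_inner_smul_right, real_inner_smul_right]
      exact mul_le_mul_of_nonneg_left (hp.2 y hy) hv'.le
    · rw [real_inner_smul_right, real_inner_smul_right]
      exact mul_le_mul_of_nonneg_left (hq.2 y hy) hv'.le
  intro x hx y hy hxy b c hb hc hbc
  by_contra hm
  set m : E := b • x + c • y with hm_def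
  have hmK : m ∈ K := K.convex hx hy hb.le hc.le hbc
  obtain ⟨v, hv, hvm⟩ : ∃ v : E, v ≠ 0 ∧ ∀ z ∈ K, ⟪z, v⟫ ≤ ⟪m, v⟫ := by
    rcases Set.eq_empty_or_nonempty (interior (K : Set E)) with hemp | hne
    · have hspan : affineSpan ℝ (K : Set E) ≠ ⊤ := fun htop => by
        have := K.convex.interior_nonempty_iff_affineSpan_eq_top.2 htop
        simp [hemp] at this
      have hdir : (affineSpan ℝ (K : Set E)).direction ≠ ⊤ := fun htop =>
        hspan ((AffineSubspace.direction_eq_top_iff_of_nonempty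
          ⟨m, subset_affineSpan ℝ _ hmK⟩).1 htop)
      have horth : (affineSpan ℝ (K : Set E)).directionᗮ ≠ ⊥ := fun hbot =>
        hdir ((Submodule.orthogonal_eq_bot_iff).1 hbot)
      obtain ⟨v, hv, hv0⟩ := Submodule.exists_mem_ne_zero_of_ne_bot horth
      refine ⟨v, hv0, fun z hz => ?_⟩
      have := (Submodule.mem_orthogonal _ v).1 hv (z - m)
        (AffineSubspace.vsub_mem_direction (subset_affineSpan ℝ _ hz) (subset_affineSpan ℝ _ hmK))
      rw [inner_sub_left] at this
      linarith
    · obtain ⟨g, hg⟩ := geometric_hahn_banach_open_point K.convex.interior isOpen_interior hm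
      obtain ⟨v, hv⟩ : ∃ v : E, ∀ z, g z = ⟪z, v⟫ := by
        refine ⟨(InnerProductSpace.toDual ℝ E).symm g, fun z => ?_⟩
        rw [real_inner_comm, InnerProductSpace.toDual_symm_apply]
      refine ⟨v, ?_, fun z hz => ?_⟩
      · rintro rfl
        obtain ⟨z, hz⟩ := hne
        have := hg z hz
        simp [hv] at this
      · have hz' : z ∈ closure (interior (K : Set E)) := by
          rw [K.convex.closure_interior_eq_closure_of_nonempty_interior hne]
          exact subset_closure hz
        rw [← hv, ← hv]
        exact closure_minimal (fun a ha => (hg a ha).le)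
          (isClosed_le g.continuous continuous_const) hz'
  have h1 := hvm x hx
  have h2 := hvm y hy
  have h3 : ⟪m, v⟫ = b * ⟪x, v⟫ + c * ⟪y, v⟫ := by
    rw [hm_def, inner_add_left, real_inner_smul_left, real_inner_smul_left]
  obtain rfl : c = 1 - b := by linarith
  have hxm : ⟪x, v⟫ = ⟪m, v⟫ := by nlinarith
  have hym : ⟪y, v⟫ = ⟪m, v⟫ := by nlinarith
  exact hxy (h' v hv x y ⟨hx, by rwa [hxm]⟩ ⟨hy, by rwa [hym]⟩)

theorem eventually_residual_strictConvex :
    ∀ᶠ K : ConvexBody E in residual (ConvexBody E), StrictConvex ℝ (K : Set E) := by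
  have key : ∀ m : ℕ, ∀ᶠ K : ConvexBody E in residual (ConvexBody E),
      ∀ v ∈ Metric.sphere (0 : E) 1, ∀ p q, IsSupportPoint K v p → IsSupportPoint K v q →
        dist p q < 1 / ((m : ℝ) + 1) := by
    intro m
    refine mem_of_superset (residual_of_dense_open isOpen_interior
      (dense_strictConvex.mono fun K hK => ?_)) interior_subset
    rw [mem_interior_iff_mem_nhds]
    refine (isCompact_sphere (0 : E) 1).eventually_forall_of_forall_eventually fun v hv => ?_
    have hv0 : v ≠ 0 := by
      rintro rfl
      simp at hv
    obtain ⟨p₀, hp₀⟩ := K.exists_isSupportPoint v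
    have hex := hp₀.isExposedPoint hK hv0
    have hm : (0 : ℝ) < 1 / ((m : ℝ) + 1) / 2 := by positivity
    by_contra hcon
    rw [not_eventually] at hcon
    set S := {z : ConvexBody E × E | ¬ ∀ p q, IsSupportPoint z.1 z.2 p → IsSupportPoint z.1 z.2 q →
        dist p q < 1 / ((m : ℝ) + 1)} with hS
    have hall : ∀ z : ConvexBody E × E, ∃ p q, z ∈ S → IsSupportPoint z.1 z.2 p ∧
        IsSupportPoint z.1 z.2 q ∧ 1 / ((m : ℝ) + 1) ≤ dist p q := by
      intro z
      by_cases hz : z ∈ S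
      · rw [hS, mem_ofPred] at hz
        push Not at hz
        obtain ⟨p, q, hp, hq, hpq⟩ := hz
        exact ⟨p, q, fun _ => ⟨hp, hq, hpq⟩⟩
      · exact ⟨0, 0, fun h => absurd h hz⟩
    choose P Q hPQ using hall
    have : (𝓝 (K, v) ⊓ 𝓟 S).NeBot := frequently_iff_neBot.1 hcon
    have hS' : ∀ᶠ z in 𝓝 (K, v) ⊓ 𝓟 S, z ∈ S := mem_inf_of_right (mem_principal_self S)
    have h1 : Tendsto (fun z : ConvexBody E × E => z.1) (𝓝 (K, v) ⊓ 𝓟 S) (𝓝 K) :=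
      (continuous_fst.tendsto (K, v)).mono_left inf_le_left
    have h2 : Tendsto (fun z : ConvexBody E × E => z.2) (𝓝 (K, v) ⊓ 𝓟 S) (𝓝 v) :=
      (continuous_snd.tendsto (K, v)).mono_left inf_le_left
    have hP := tendsto_supportPoint hex h1 h2 (hS'.mono fun z hz => (hPQ z hz).1)
    have hQ := tendsto_supportPoint hex h1 h2 (hS'.mono fun z hz => (hPQ z hz).2.1)
    have hd := hP.dist hQ
    rw [dist_self] at hd
    obtain ⟨z, hz, hzS⟩ := ((hd.eventually_lt_const (by positivity :
      (0 : ℝ) < 1 / ((m : ℝ) + 1))).and hS').exists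
    exact absurd hz (not_lt.2 (hPQ z hzS).2.2)
  filter_upwards [eventually_countable_forall.2 key] with K hK
  refine ConvexBody.strictConvex_of_isSupportPoint_unique fun v hv p q hp hq => ?_
  by_contra hpq
  obtain ⟨m, hm⟩ := exists_nat_one_div_lt (dist_pos.2 hpq)
  exact absurd hm (not_lt.2 (hK m v (by simpa using hv) p q hp hq).le)

end SupportPoints

/-- In a subset `R` of a product whose projection to the first factor is open, almost every
section of an open dense subset of `R` is dense in the corresponding section of `R`. -/
theorem eventually_residual_section_dense {X Y : Type*} [TopologicalSpace X] [TopologicalSpace Y]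
    [SecondCountableTopology Y] {R : Set (X × Y)} (hR : IsOpenMap fun q : R => q.1.1)
    {G : Set R} (hG : IsOpen G) (hd : Dense G) :
    ∀ᶠ x in residual X, ∀ V : Set Y, IsOpen V → (∃ y ∈ V, (x, y) ∈ R) →
      ∃ y ∈ V, ∃ h : (x, y) ∈ R, (⟨(x, y), h⟩ : R) ∈ G := by
  have key : ∀ W ∈ TopologicalSpace.countableBasis Y, ∀ᶠ x in residual X,
      (∃ y ∈ W, (x, y) ∈ R) → ∃ y ∈ W, ∃ h : (x, y) ∈ R, (⟨(x, y), h⟩ : R) ∈ G := by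
    intro W hW
    have hWo : IsOpen {q : R | q.1.2 ∈ W} :=
      (TopologicalSpace.isOpen_of_mem_countableBasis hW).preimage (by fun_prop)
    set B : Set X := (fun q : R => q.1.1) '' ({q : R | q.1.2 ∈ W} ∩ G)
    have hB : IsOpen B := hR _ (hWo.inter hG)
    refine mem_of_superset (residual_of_dense_open (s := B ∪ (closure B)ᶜ)
      (hB.union isClosed_closure.isOpen_compl) fun x => ?_) ?_
    · by_cases hx : x ∈ closure B
      · exact closure_mono subset_union_left hx
      · exact subset_closure (Or.inr hx)
    · rintro x (⟨q, ⟨hqW, hqG⟩, rfl⟩ | hx) ⟨y, hyW, hyR⟩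
      · exact ⟨q.1.2, hqW, q.2, hqG⟩
      · refine absurd ?_ hx
        have hcl : (⟨(x, y), hyR⟩ : R) ∈ closure ({q : R | q.1.2 ∈ W} ∩ G) :=
          hd.open_subset_closure_inter hWo hyW
        exact image_closure_subset_closure_image (by fun_prop) (mem_image_of_mem _ hcl)
  filter_upwards [(eventually_countable_ball (TopologicalSpace.countable_countableBasis Y)).2 key]
    with x hx V hV ⟨y, hyV, hyR⟩
  obtain ⟨W, hW, hyW, hWV⟩ :=
    (TopologicalSpace.isBasis_countableBasis Y).exists_subset_of_mem_open hyV hV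
  obtain ⟨y', hy', h⟩ := hx W hW ⟨y, hyW, hyR⟩
  exact ⟨y', hWV hy', h⟩

/-- The unit tangent bundle of the sphere. -/
def unitTangentBundle (n : ℕ) :
    Set (Metric.sphere (0 : EuclideanSpace ℝ (Fin n)) 1 × EuclideanSpace ℝ (Fin n)) :=
  {q | q.2 ∈ Metric.sphere (0 : EuclideanSpace ℝ (Fin n)) 1 ∧
    ⟪q.2, (q.1 : EuclideanSpace ℝ (Fin n))⟫ = 0}

theorem isOpenMap_unitTangentBundle_fst :
    IsOpenMap fun q : unitTangentBundle n => q.1.1 := by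
  rw [isOpenMap_iff_nhds_le]
  rintro ⟨⟨u, t⟩, hq⟩ s hs
  rw [mem_map, nhds_subtype_eq_comap, mem_comap] at hs
  obtain ⟨U, hU, hUs⟩ := hs
  have ht1 : ‖t‖ = 1 := by simpa using hq.1
  set p : Metric.sphere (0 : EuclideanSpace ℝ (Fin n)) 1 → EuclideanSpace ℝ (Fin n) :=
    fun v => t - ⟪t, (v : EuclideanSpace ℝ (Fin n))⟫ • (v : EuclideanSpace ℝ (Fin n))
  have hpc : Continuous p := by fun_prop
  have hpu : p u = t := by
    have : ⟪t, (u : EuclideanSpace ℝ (Fin n))⟫ = 0 := hq.2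
    simp [p, this]
  have hp0 : p u ≠ 0 := by
    rw [hpu]
    rintro rfl
    simp at ht1
  have hσ : Tendsto (fun v => (v, ‖p v‖⁻¹ • p v)) (𝓝 u) (𝓝 (u, t)) := by
    have h := (hpc.continuousAt (x := u)).norm.inv₀ (norm_ne_zero_iff.2 hp0)
    have h' : Tendsto (fun v => ‖p v‖⁻¹ • p v) (𝓝 u) (𝓝 (‖p u‖⁻¹ • p u)) :=
      h.smul hpc.continuousAt
    rw [hpu, ht1, inv_one, one_smul] at h'
    exact tendsto_id.prodMk_nhds h'
  filter_upwards [hσ.eventually hU, hpc.continuousAt.eventually_ne hp0] with v hvU hv0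
  have hv1 : ‖(v : EuclideanSpace ℝ (Fin n))‖ = 1 := by simp
  have hmem : (v, ‖p v‖⁻¹ • p v) ∈ unitTangentBundle n := by
    refine ⟨by simpa using norm_smul_inv_norm (𝕜 := ℝ) hv0, ?_⟩
    change ⟪‖p v‖⁻¹ • p v, (v : EuclideanSpace ℝ (Fin n))⟫ = 0
    simp only [p, real_inner_smul_left, inner_sub_left, real_inner_self_eq_norm_sq, hv1]
    ring
  have h : (⟨_, hmem⟩ : unitTangentBundle n) ∈
      (fun q : unitTangentBundle n => q.1.1) ⁻¹' s := hUs hvU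
  exact h

section Turns

/-- The map `z` turns at `u` in direction `t` within parameters smaller than `ε`. -/
def TurnsWithin (z : EuclideanSpace ℝ (Fin n) → EuclideanSpace ℝ (Fin n)) (ε : ℝ)
    (u t : EuclideanSpace ℝ (Fin n)) : Prop :=
  ∃ lam mu : ℝ, 0 < lam ∧ lam < ε ∧ 0 < mu ∧ mu < ε ∧
    0 < ⟪z (boxplus u t lam) - z u, t⟫ * ⟪z (boxplus u t (-mu)) - z u, t⟫

theorem makesTurn_of_forall_turnsWithin
    {z : EuclideanSpace ℝ (Fin n) → EuclideanSpace ℝ (Fin n)} {u t : EuclideanSpace ℝ (Fin n)}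
    (h : ∀ m : ℕ, TurnsWithin z (1 / ((m : ℝ) + 1)) u t) : MakesTurn z u t := by
  intro ε hε
  obtain ⟨m, hm⟩ := exists_nat_one_div_lt hε
  obtain ⟨lam, mu, h1, h2, h3, h4, h5⟩ := h m
  exact ⟨lam, mu, h1, h2.trans hm, h3, h4.trans hm, h5⟩

theorem add_smul_ne_zero_of_inner_eq_zero {u t : EuclideanSpace ℝ (Fin n)} (hu : ‖u‖ = 1)
    (htu : ⟪t, u⟫ = 0) (l : ℝ) : u + l • t ≠ 0 := by
  intro h
  have h1 : ⟪u + l • t, u⟫ = 1 := by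
    rw [inner_add_left, real_inner_smul_left, htu, real_inner_self_eq_norm_sq, hu]
    norm_num
  simp [h] at h1

theorem boxplus_mem_sphere {u t : EuclideanSpace ℝ (Fin n)} (hu : ‖u‖ = 1)
    (htu : ⟪t, u⟫ = 0) (l : ℝ) :
    boxplus u t l ∈ Metric.sphere (0 : EuclideanSpace ℝ (Fin n)) 1 := by
  rw [mem_sphere_zero_iff_norm]
  exact norm_smul_inv_norm (𝕜 := ℝ) (add_smul_ne_zero_of_inner_eq_zero hu htu l)

theorem tendsto_boxplus_zero {u : EuclideanSpace ℝ (Fin n)} (hu : ‖u‖ = 1)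
    (t : EuclideanSpace ℝ (Fin n)) : Tendsto (boxplus u t) (𝓝 0) (𝓝 u) := by
  have h : Tendsto (fun l : ℝ => u + l • t) (𝓝 0) (𝓝 u) := by
    have hc : Continuous fun l : ℝ => u + l • t := by fun_prop
    simpa using hc.tendsto 0
  have h' := (h.norm.inv₀ (by simp [hu])).smul h
  rw [hu, inv_one, one_smul] at h'
  exact h'

theorem isOpen_turnsWithin {z : EuclideanSpace ℝ (Fin n) → EuclideanSpace ℝ (Fin n)}
    (hz : ContinuousOn z (Metric.sphere 0 1)) (ε : ℝ) :
    IsOpen {q : unitTangentBundle n | TurnsWithin z ε q.1.1 q.1.2} := by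
  have hu : ∀ q : unitTangentBundle n, ‖(q.1.1 : EuclideanSpace ℝ (Fin n))‖ = 1 :=
    fun q => by simp
  have h0 : Continuous fun q : unitTangentBundle n => z q.1.1 :=
    hz.comp_continuous (by fun_prop) fun q => q.1.1.2
  have hb : ∀ l : ℝ, Continuous fun q : unitTangentBundle n => z (boxplus q.1.1 q.1.2 l) := by
    intro l
    refine hz.comp_continuous ?_ fun q => boxplus_mem_sphere (hu q) q.2.2 l
    have hc : Continuous fun q : unitTangentBundle n =>
        (q.1.1 : EuclideanSpace ℝ (Fin n)) + l • q.1.2 := by fun_prop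
    exact (hc.norm.inv₀ fun q =>
      norm_ne_zero_iff.2 (add_smul_ne_zero_of_inner_eq_zero (hu q) q.2.2 l)).smul hc
  rw [isOpen_iff_eventually]
  rintro q ⟨lam, mu, h1, h2, h3, h4, h5⟩
  have hc : Continuous fun q : unitTangentBundle n =>
      ⟪z (boxplus q.1.1 q.1.2 lam) - z q.1.1, q.1.2⟫ *
        ⟪z (boxplus q.1.1 q.1.2 (-mu)) - z q.1.1, q.1.2⟫ := by
    have ht : Continuous fun q : unitTangentBundle n => q.1.2 := by fun_prop
    exact (((hb lam).sub h0).inner ht).mul (((hb (-mu)).sub h0).inner ht)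
  filter_upwards [hc.continuousAt.eventually_const_lt h5] with r hr
  exact ⟨lam, mu, h1, h2, h3, h4, hr⟩

variable {x : ConvexBody (EuclideanSpace ℝ (Fin n)) →
      EuclideanSpace ℝ (Fin n) → EuclideanSpace ℝ (Fin n)}

theorem continuousOn_of_isSupportPoint {K : ConvexBody (EuclideanSpace ℝ (Fin n))}
    (hK : StrictConvex ℝ (K : Set (EuclideanSpace ℝ (Fin n))))
    {f : EuclideanSpace ℝ (Fin n) → EuclideanSpace ℝ (Fin n)}
    (hf : ∀ v ∈ Metric.sphere (0 : EuclideanSpace ℝ (Fin n)) 1, IsSupportPoint K v (f v)) :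
    ContinuousOn f (Metric.sphere 0 1) := fun v hv =>
  tendsto_supportPoint ((hf v hv).isExposedPoint hK (ne_zero_of_mem_unit_sphere ⟨v, hv⟩))
    tendsto_const_nhds (tendsto_id.mono_left nhdsWithin_le_nhds)
    (eventually_mem_nhdsWithin.mono hf)

theorem eventually_nhds_turnsWithin
    (hx : ∀ K : ConvexBody (EuclideanSpace ℝ (Fin n)),
      StrictConvex ℝ (K : Set (EuclideanSpace ℝ (Fin n))) →
      ∀ v ∈ Metric.sphere (0 : EuclideanSpace ℝ (Fin n)) 1, IsSupportPoint K v (x K v))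
    {u t : EuclideanSpace ℝ (Fin n)} (hu : ‖u‖ = 1) (htu : ⟪t, u⟫ = 0) {ε lam mu : ℝ}
    (hlam0 : 0 < lam) (hlam : lam < ε) (hmu0 : 0 < mu) (hmu : mu < ε)
    {K L : ConvexBody (EuclideanSpace ℝ (Fin n))} {a b c d e f : EuclideanSpace ℝ (Fin n)}
    (ha : IsExposedPoint K (boxplus u t lam) a) (hb : IsExposedPoint L (boxplus u t lam) b)
    (hc : IsExposedPoint K u c) (hd : IsExposedPoint L u d)
    (he : IsExposedPoint K (boxplus u t (-mu)) e) (hf : IsExposedPoint L (boxplus u t (-mu)) f)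
    (hpos : 0 < ⟪a - b - (c - d), t⟫ * ⟪e - f - (c - d), t⟫) :
    ∀ᶠ p : ConvexBody (EuclideanSpace ℝ (Fin n)) × ConvexBody (EuclideanSpace ℝ (Fin n)) in
      𝓝 (K, L), StrictConvex ℝ (p.1 : Set (EuclideanSpace ℝ (Fin n))) →
        StrictConvex ℝ (p.2 : Set (EuclideanSpace ℝ (Fin n))) →
        TurnsWithin (fun v => x p.1 v - x p.2 v) ε u t := by
  set S : Set (ConvexBody (EuclideanSpace ℝ (Fin n)) × ConvexBody (EuclideanSpace ℝ (Fin n))) :=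
    {p | StrictConvex ℝ (p.1 : Set (EuclideanSpace ℝ (Fin n))) ∧
      StrictConvex ℝ (p.2 : Set (EuclideanSpace ℝ (Fin n)))}
  have h1 : Tendsto Prod.fst (𝓝[S] (K, L)) (𝓝 K) :=
    (continuous_fst.tendsto (K, L)).mono_left nhdsWithin_le_nhds
  have h2 : Tendsto Prod.snd (𝓝[S] (K, L)) (𝓝 L) :=
    (continuous_snd.tendsto (K, L)).mono_left nhdsWithin_le_nhds
  have hK : ∀ v ∈ Metric.sphere (0 : EuclideanSpace ℝ (Fin n)) 1, ∀ y, IsExposedPoint K v y →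
      Tendsto (fun p => x p.1 v) (𝓝[S] (K, L)) (𝓝 y) := fun v hv y hy =>
    tendsto_supportPoint hy h1 tendsto_const_nhds
      (eventually_mem_nhdsWithin.mono fun p hp => hx p.1 hp.1 v hv)
  have hL : ∀ v ∈ Metric.sphere (0 : EuclideanSpace ℝ (Fin n)) 1, ∀ y, IsExposedPoint L v y →
      Tendsto (fun p => x p.2 v) (𝓝[S] (K, L)) (𝓝 y) := fun v hv y hy =>
    tendsto_supportPoint hy h2 tendsto_const_nhds
      (eventually_mem_nhdsWithin.mono fun p hp => hx p.2 hp.2 v hv)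
  have hus : u ∈ Metric.sphere (0 : EuclideanSpace ℝ (Fin n)) 1 := by simpa using hu
  have hbs := boxplus_mem_sphere hu htu
  have h0 := (hK u hus c hc).sub (hL u hus d hd)
  have hl := (((hK _ (hbs _) a ha).sub (hL _ (hbs _) b hb)).sub h0).inner (𝕜 := ℝ)
    (tendsto_const_nhds (x := t))
  have hm := (((hK _ (hbs _) e he).sub (hL _ (hbs _) f hf)).sub h0).inner (𝕜 := ℝ)
    (tendsto_const_nhds (x := t))
  have := (hl.mul hm).eventually_const_lt hpos
  rw [eventually_nhdsWithin_iff] at this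
  filter_upwards [this] with p hp hp1 hp2
  exact ⟨lam, mu, hlam0, hlam, hmu0, hmu, hp ⟨hp1, hp2⟩⟩

theorem eventually_residual_turnsWithin
    (hx : ∀ K : ConvexBody (EuclideanSpace ℝ (Fin n)),
      StrictConvex ℝ (K : Set (EuclideanSpace ℝ (Fin n))) →
      ∀ v ∈ Metric.sphere (0 : EuclideanSpace ℝ (Fin n)) 1, IsSupportPoint K v (x K v))
    {u t : EuclideanSpace ℝ (Fin n)} (hu : ‖u‖ = 1) (ht : ‖t‖ = 1) (htu : ⟪t, u⟫ = 0) {ε : ℝ}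
    (hε : 0 < ε) :
    ∀ᶠ p : ConvexBody (EuclideanSpace ℝ (Fin n)) × ConvexBody (EuclideanSpace ℝ (Fin n)) in
      residual _, StrictConvex ℝ (p.1 : Set (EuclideanSpace ℝ (Fin n))) →
        StrictConvex ℝ (p.2 : Set (EuclideanSpace ℝ (Fin n))) →
        TurnsWithin (fun v => x p.1 v - x p.2 v) ε u t := by
  refine mem_of_superset (residual_of_dense_open isOpen_interior ?_) interior_subset
  refine Dense.of_closure ((dense_strictConvex.prod dense_strictConvex).mono ?_)
  rintro ⟨K, L⟩ ⟨hK, hL⟩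
  rw [Metric.mem_closure_iff]
  intro η hη
  have hus : u ∈ Metric.sphere (0 : EuclideanSpace ℝ (Fin n)) 1 := by simpa using hu
  have hbs := boxplus_mem_sphere hu htu
  have hexp : ∀ {M : ConvexBody (EuclideanSpace ℝ (Fin n))},
      StrictConvex ℝ (M : Set (EuclideanSpace ℝ (Fin n))) →
      ∀ v ∈ Metric.sphere (0 : EuclideanSpace ℝ (Fin n)) 1, IsExposedPoint M v (x M v) :=
    fun hM v hv => (hx _ hM v hv).isExposedPoint hM (ne_zero_of_mem_unit_sphere ⟨v, hv⟩)
  have hlim : ∀ {M : ConvexBody (EuclideanSpace ℝ (Fin n))},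
      StrictConvex ℝ (M : Set (EuclideanSpace ℝ (Fin n))) →
      Tendsto (fun s => x M (boxplus u t s)) (𝓝 0) (𝓝 (x M u)) := fun hM =>
    tendsto_supportPoint (hexp hM u hus) tendsto_const_nhds (tendsto_boxplus_zero hu t)
      (Eventually.of_forall fun s => hx _ hM _ (hbs s))
  obtain ⟨δ, hδ0, hδη⟩ : ∃ δ > 0, 2 * δ < η := ⟨η / 4, by positivity, by linarith⟩
  have hD : Tendsto (fun s => ⟪x K (boxplus u t s) - x L (boxplus u t s) - (x K u - x L u), t⟫)
      (𝓝 0) (𝓝 0) := by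
    have := (((hlim hK).sub (hlim hL)).sub
      (tendsto_const_nhds (x := x K u - x L u))).inner (𝕜 := ℝ) (tendsto_const_nhds (x := t))
    simpa using this
  obtain ⟨r, hr0, hr⟩ := Metric.eventually_nhds_iff.1 (hD.eventually_const_lt (neg_lt_zero.2 hδ0))
  obtain ⟨l, hl0, hlr, hlε, hl2⟩ : ∃ l > 0, l < r ∧ l < ε ∧ l < 2 := by
    have : 0 < min r (min ε 2) := by positivity
    obtain ⟨l, hl0, hl⟩ := exists_between this
    simp only [lt_min_iff] at hl
    exact ⟨l, hl0, hl.1, hl.2.1, hl.2.2⟩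
  have huu : ⟪u, u⟫ = 1 := by rw [real_inner_self_eq_norm_sq, hu]; norm_num
  have htt : ⟪t, t⟫ = 1 := by rw [real_inner_self_eq_norm_sq, ht]; norm_num
  have hut : ⟪u, t⟫ = 0 := by rw [real_inner_comm, htu]
  set w₁ : EuclideanSpace ℝ (Fin n) := δ • (t - (l / 2) • u) with hw₁
  set w₂ : EuclideanSpace ℝ (Fin n) := δ • (-t - (l / 2) • u) with hw₂
  have hnorm : ‖w₁‖ < η ∧ ‖w₂‖ < η := by
    have h1 := norm_sub_le t ((l / 2) • u)
    have h2 := norm_sub_le (-t) ((l / 2) • u)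
    rw [norm_neg] at h2
    rw [norm_smul, hu, ht, Real.norm_of_nonneg (by positivity)] at h1 h2
    rw [hw₁, hw₂, norm_smul, norm_smul, Real.norm_of_nonneg hδ0.le]
    constructor <;> nlinarith
  have hsign : ∀ (w : EuclideanSpace ℝ (Fin n)) (s : ℝ), ∃ k > 0,
      ⟪w, boxplus u t s⟫ = k * (⟪w, u⟫ + s * ⟪w, t⟫) := fun w s =>
    ⟨‖u + s • t‖⁻¹, inv_pos.2 (norm_pos_iff.2 (add_smul_ne_zero_of_inner_eq_zero hu htu s)), by
      rw [boxplus, real_inner_smul_right, inner_add_right, real_inner_smul_right]⟩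
  have hw₁u : ⟪w₁, u⟫ = -(δ * (l / 2)) := by
    rw [hw₁, real_inner_smul_left, inner_sub_left, real_inner_smul_left, htu, huu]; ring
  have hw₂u : ⟪w₂, u⟫ = -(δ * (l / 2)) := by
    rw [hw₂, real_inner_smul_left, inner_sub_left, inner_neg_left, real_inner_smul_left, htu, huu]
    ring
  have hw₁t : ⟪w₁, t⟫ = δ := by
    rw [hw₁, real_inner_smul_left, inner_sub_left, real_inner_smul_left, htt, hut]; ring
  have hw₂t : ⟪w₂, t⟫ = -δ := by
    rw [hw₂, real_inner_smul_left, inner_sub_left, inner_neg_left, real_inner_smul_left, htt, hut]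
    ring
  have hδl : 0 < δ * l := by positivity
  have h1u : ⟪w₁, u⟫ < 0 := by rw [hw₁u]; linarith
  have h2u : ⟪w₂, u⟫ < 0 := by rw [hw₂u]; linarith
  have h1l : 0 < ⟪w₁, boxplus u t l⟫ := by
    obtain ⟨k, hk, h⟩ := hsign w₁ l
    rw [h, hw₁u, hw₁t]
    exact mul_pos hk (by linarith)
  have h2l : ⟪w₂, boxplus u t l⟫ < 0 := by
    obtain ⟨k, hk, h⟩ := hsign w₂ l
    rw [h, hw₂u, hw₂t]
    exact mul_neg_of_pos_of_neg hk (by linarith)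
  have h1m : ⟪w₁, boxplus u t (-l)⟫ < 0 := by
    obtain ⟨k, hk, h⟩ := hsign w₁ (-l)
    rw [h, hw₁u, hw₁t]
    exact mul_neg_of_pos_of_neg hk (by linarith)
  have h2m : 0 < ⟪w₂, boxplus u t (-l)⟫ := by
    obtain ⟨k, hk, h⟩ := hsign w₂ (-l)
    rw [h, hw₂u, hw₂t]
    exact mul_pos hk (by linarith)
  refine ⟨(K + ConvexBody.zeroSegment w₁, L + ConvexBody.zeroSegment w₂), ?_, ?_⟩
  · refine mem_interior_iff_mem_nhds.2 (eventually_nhds_turnsWithin hx hu htu hl0 hlε hl0 hlε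
      ((hexp hK _ (hbs l)).add (isExposedPoint_zeroSegment_of_pos h1l))
      ((hexp hL _ (hbs l)).add (isExposedPoint_zeroSegment_of_neg h2l))
      ((hexp hK _ hus).add (isExposedPoint_zeroSegment_of_neg h1u))
      ((hexp hL _ hus).add (isExposedPoint_zeroSegment_of_neg h2u))
      ((hexp hK _ (hbs (-l))).add (isExposedPoint_zeroSegment_of_neg h1m))
      ((hexp hL _ (hbs (-l))).add (isExposedPoint_zeroSegment_of_pos h2m)) ?_)
    have hl := hr (y := l) (by rw [Real.dist_0_eq_abs, abs_of_pos hl0]; exact hlr)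
    have hm := hr (y := -l) (by rw [Real.dist_0_eq_abs, abs_neg, abs_of_pos hl0]; exact hlr)
    simp only [inner_sub_left, inner_add_left, inner_zero_left, hw₁t, hw₂t] at hl hm ⊢
    exact mul_pos (by linarith) (by linarith)
  · rw [Prod.dist_eq, max_lt_iff, dist_comm K, dist_comm L]
    exact ⟨(K.dist_add_zeroSegment_le w₁).trans_lt hnorm.1,
      (L.dist_add_zeroSegment_le w₂).trans_lt hnorm.2⟩

theorem mem_residual_makesTurn {z : EuclideanSpace ℝ (Fin n) → EuclideanSpace ℝ (Fin n)}
    (hz : ContinuousOn z (Metric.sphere 0 1))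
    (hd : ∀ m : ℕ,
      Dense {q : unitTangentBundle n | TurnsWithin z (1 / ((m : ℝ) + 1)) q.1.1 q.1.2}) :
    {u : (Metric.sphere (0 : EuclideanSpace ℝ (Fin n)) 1) |
        {t : {t : EuclideanSpace ℝ (Fin n) //
            t ∈ Metric.sphere (0 : EuclideanSpace ℝ (Fin n)) 1 ∧
            ⟪t, (u : EuclideanSpace ℝ (Fin n))⟫ = 0} |
          MakesTurn z (u : EuclideanSpace ℝ (Fin n)) (t : _)} ∈
          residual {t : EuclideanSpace ℝ (Fin n) //
            t ∈ Metric.sphere (0 : EuclideanSpace ℝ (Fin n)) 1 ∧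
            ⟪t, (u : EuclideanSpace ℝ (Fin n))⟫ = 0}} ∈
        residual (Metric.sphere (0 : EuclideanSpace ℝ (Fin n)) 1) := by
  have hG := fun m : ℕ => isOpen_turnsWithin hz (1 / ((m : ℝ) + 1))
  filter_upwards [eventually_countable_forall.2 fun m =>
    eventually_residual_section_dense isOpenMap_unitTangentBundle_fst (hG m) (hd m)] with u hu
  set T := {t : EuclideanSpace ℝ (Fin n) // t ∈ Metric.sphere (0 : EuclideanSpace ℝ (Fin n)) 1 ∧
    ⟪t, (u : EuclideanSpace ℝ (Fin n))⟫ = 0}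
  have key : ∀ m : ℕ, ∀ᶠ t : T in residual T, TurnsWithin z (1 / ((m : ℝ) + 1)) u t.1 := by
    intro m
    refine residual_of_dense_open ?_ ?_
    · have hc : Continuous fun t : T => (⟨(u, t.1), t.2⟩ : unitTangentBundle n) := by fun_prop
      exact (hG m).preimage hc
    · rw [dense_iff_inter_open]
      rintro U hU ⟨t, htU⟩
      obtain ⟨V, hV, rfl⟩ := isOpen_induced_iff.1 hU
      obtain ⟨y, hyV, hy, hyG⟩ := hu m V hV ⟨t.1, htU, t.2⟩
      exact ⟨⟨y, hy⟩, hyV, hyG⟩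
  filter_upwards [eventually_countable_forall.2 key] with t ht
  exact makesTurn_of_forall_turnsWithin ht

end Turns

/-- Main theorem: most pairs `(K,L)` of convex bodies in `ℝⁿ` (in the sense of Baire category
for the Hausdorff metric) are such that `K` and `L` are strictly convex and, for most
`u ∈ S^{n-1}`, for most `t ∈ T_u`, the reverse Gauss map `x_{K,L} = x_K − x_L` makes a turn at
`u` in direction `t`. Here `x` is any choice of reverse Gauss map on strictly convex bodies. -/
theorem stmt18
    (x : ConvexBody (EuclideanSpace ℝ (Fin n)) →
      EuclideanSpace ℝ (Fin n) → EuclideanSpace ℝ (Fin n))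
    (hx : ∀ K : ConvexBody (EuclideanSpace ℝ (Fin n)),
      StrictConvex ℝ (K : Set (EuclideanSpace ℝ (Fin n))) →
      ∀ v ∈ Metric.sphere (0 : EuclideanSpace ℝ (Fin n)) 1,
        x K v ∈ K ∧ IsMaxOn (fun y => ⟪y, v⟫) (K : Set (EuclideanSpace ℝ (Fin n))) (x K v)) :
    {p : ConvexBody (EuclideanSpace ℝ (Fin n)) × ConvexBody (EuclideanSpace ℝ (Fin n)) |
      StrictConvex ℝ (p.1 : Set (EuclideanSpace ℝ (Fin n))) ∧
      StrictConvex ℝ (p.2 : Set (EuclideanSpace ℝ (Fin n))) ∧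
      {u : (Metric.sphere (0 : EuclideanSpace ℝ (Fin n)) 1) |
        {t : {t : EuclideanSpace ℝ (Fin n) //
            t ∈ Metric.sphere (0 : EuclideanSpace ℝ (Fin n)) 1 ∧
            ⟪t, (u : EuclideanSpace ℝ (Fin n))⟫ = 0} |
          MakesTurn (fun v => x p.1 v - x p.2 v) (u : EuclideanSpace ℝ (Fin n)) (t : _)} ∈
          residual {t : EuclideanSpace ℝ (Fin n) //
            t ∈ Metric.sphere (0 : EuclideanSpace ℝ (Fin n)) 1 ∧
            ⟪t, (u : EuclideanSpace ℝ (Fin n))⟫ = 0}} ∈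
        residual (Metric.sphere (0 : EuclideanSpace ℝ (Fin n)) 1)} ∈
      residual (ConvexBody (EuclideanSpace ℝ (Fin n)) ×
        ConvexBody (EuclideanSpace ℝ (Fin n))) := by
  have hx' : ∀ K : ConvexBody (EuclideanSpace ℝ (Fin n)),
      StrictConvex ℝ (K : Set (EuclideanSpace ℝ (Fin n))) →
      ∀ v ∈ Metric.sphere (0 : EuclideanSpace ℝ (Fin n)) 1, IsSupportPoint K v (x K v) :=
    fun K hK v hv => ⟨(hx K hK v hv).1, fun y hy => (hx K hK v hv).2 hy⟩
  obtain ⟨D, hDc, hDd⟩ := TopologicalSpace.exists_countable_dense (unitTangentBundle n)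
  have hturn : ∀ m : ℕ, ∀ q ∈ D, ∀ᶠ p : ConvexBody (EuclideanSpace ℝ (Fin n)) ×
      ConvexBody (EuclideanSpace ℝ (Fin n)) in residual _,
      StrictConvex ℝ (p.1 : Set (EuclideanSpace ℝ (Fin n))) →
        StrictConvex ℝ (p.2 : Set (EuclideanSpace ℝ (Fin n))) →
        TurnsWithin (fun v => x p.1 v - x p.2 v) (1 / ((m : ℝ) + 1)) q.1.1 q.1.2 :=
    fun m q _ => eventually_residual_turnsWithin hx' (by simp)
      (by simpa using q.2.1) q.2.2 (by positivity)
  filter_upwards [(tendsto_residual_of_isOpenMap continuous_fst isOpenMap_fst).eventually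
      eventually_residual_strictConvex,
    (tendsto_residual_of_isOpenMap continuous_snd isOpenMap_snd).eventually
      eventually_residual_strictConvex,
    eventually_countable_forall.2 fun m => (eventually_countable_ball hDc).2 (hturn m)]
    with p h1 h2 hp
  exact ⟨h1, h2, mem_residual_makesTurn ((continuousOn_of_isSupportPoint h1 (hx' _ h1)).sub
    (continuousOn_of_isSupportPoint h2 (hx' _ h2))) fun m =>
    hDd.mono fun q hq => hp m q hq h1 h2⟩
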